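/- Let n ≥ 3, let id be the identity permutation of [n], id⁻ the permutation j ↦ n+1−j, and let U be a nonempty proper subset of [n]. The half-line M(id) + ℝ≥0·M(χ^U) is an extreme subset of closure(Q_n) (i.e., an unbounded edge) if and only if there exists a symmetric n×n real matrix D with zero diagonal such that: D•M(π) > D•M(id) for every permutation π of [n] with π ≠ id and π ≠ id⁻; D•M(χ^{U′}) > 0 for every nonempty proper subset U′ ⊊ [n] with U′ ≠ U and U′ ≠ [n]∖U; and D•M(χ^U) = 0. -/

import Mathlib

open scoped BigOperators Pointwise

noncomputable def mmap {n : ℕ} (x : Fin n → ℝ) : Matrix (Fin n) (Fin n) ℝ :=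
  fun k l => |x k - x l|

noncomputable def chi {n : ℕ} (U : Finset (Fin n)) : Fin n → ℝ :=
  fun j => if j ∈ U then 1 else 0

noncomputable def permVec {n : ℕ} (π : Equiv.Perm (Fin n)) : Fin n → ℝ :=
  fun j => ((π j : ℕ) : ℝ) + 1

noncomputable def Mperm {n : ℕ} (π : Equiv.Perm (Fin n)) : Matrix (Fin n) (Fin n) ℝ :=
  mmap (permVec π)

def Npi {n : ℕ} (π : Equiv.Perm (Fin n)) : Set (Fin n → ℝ) :=
  {x | (∑ k, x k) = 0 ∧ ∀ k l : Fin n, π k < π l → x k ≤ x l}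

def Ebn (n : ℕ) : Set (Matrix (Fin n) (Fin n) ℝ) :=
  {X | ∃ x : Fin n → ℝ, (∀ k l : Fin n, k ≠ l → 1 ≤ |x k - x l|) ∧ X = mmap x}

noncomputable def Qn (n : ℕ) : Set (Matrix (Fin n) (Fin n) ℝ) :=
  convexHull ℝ (Ebn n)

noncomputable def Pn (n : ℕ) : Set (Matrix (Fin n) (Fin n) ℝ) :=
  convexHull ℝ {X | ∃ π : Equiv.Perm (Fin n), X = Mperm π}

noncomputable def cutCone (n : ℕ) : Set (Matrix (Fin n) (Fin n) ℝ) :=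
  {X | ∃ lam : Finset (Fin n) → ℝ, (∀ U, 0 ≤ lam U) ∧
    X = ∑ U : Finset (Fin n), lam U • mmap (chi U)}

def incident {n : ℕ} (π : Equiv.Perm (Fin n)) (U : Finset (Fin n)) : Prop :=
  U.Nonempty ∧ U ≠ Finset.univ ∧ ∀ j, j ∈ U ↔ (π j : ℕ) + 1 ≤ U.card

def overRidge {n : ℕ} (π : Equiv.Perm (Fin n)) (V : Finset (Fin n)) : Prop :=
  ∃ k : ℕ, 1 ≤ k ∧ k ≤ n - 1 ∧
    ∀ j, j ∈ V ↔ ((π j : ℕ) + 1 ≤ k - 1 ∨ (π j : ℕ) + 1 = k + 1)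

noncomputable def halfline {n : ℕ} (π : Equiv.Perm (Fin n)) (U : Finset (Fin n)) :
    Set (Matrix (Fin n) (Fin n) ℝ) :=
  {X | ∃ t : ℝ, 0 ≤ t ∧ X = Mperm π + t • mmap (chi U)}

noncomputable def antipode {n : ℕ} (π : Equiv.Perm (Fin n)) : Equiv.Perm (Fin n) :=
  π.trans Fin.revPerm

noncomputable def mdot {n : ℕ} (A B : Matrix (Fin n) (Fin n) ℝ) : ℝ :=
  ∑ k, ∑ l, A k l * B k l


attribute [local instance] Matrix.normedAddCommGroup Matrix.normedSpace

theorem aux_add {n : ℕ} (a b : Fin n → ℝ)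
    (h : ∀ k l, 0 ≤ (a k - a l) * (b k - b l)) :
    mmap (fun k => a k + b k) = mmap a + mmap b := by
  ext k l
  show |(a k + b k) - (a l + b l)| = |a k - a l| + |b k - b l|
  have e : (a k + b k) - (a l + b l) = (a k - a l) + (b k - b l) := by ring
  rw [e, abs_add_eq_add_abs_iff]
  exact mul_nonneg_iff.mp (h k l)

theorem aux_smul {n : ℕ} (c : ℝ) (hc : 0 ≤ c) (a : Fin n → ℝ) :
    mmap (fun k => c * a k) = c • mmap a := by
  ext k l
  show |c * a k - c * a l| = c * |a k - a l|
  rw [← mul_sub, abs_mul, abs_of_nonneg hc]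

/-- A set closed under adding nonnegative multiples of cuts is closed under adding `mmap z`. -/
theorem aux_cone {n : ℕ} (S : Set (Matrix (Fin n) (Fin n) ℝ))
    (hS : ∀ X ∈ S, ∀ (U : Finset (Fin n)) (c : ℝ), 0 ≤ c → X + c • mmap (chi U) ∈ S) :
    ∀ (N : ℕ) (z : Fin n → ℝ), (Finset.univ.image z).card ≤ N →
      ∀ X ∈ S, X + mmap z ∈ S := by
  intro N
  induction N with
  | zero =>
    intro z hz X hX
    have h0 : mmap z = 0 := by
      ext k l
      exfalso
      have : z k ∈ Finset.univ.image z := Finset.mem_image_of_mem _ (Finset.mem_univ _)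
      rw [Finset.card_eq_zero.mp (Nat.le_zero.mp hz)] at this
      simp at this
    rw [h0, add_zero]; exact hX
  | succ N ih =>
    intro z hz X hX
    by_cases hI : (Finset.univ.image z).Nonempty
    swap
    · apply ih z _ X hX
      rw [Finset.not_nonempty_iff_eq_empty] at hI
      rw [hI]; simp
    set I := Finset.univ.image z with hIdef
    set m := I.max' hI with hm
    have hzm : ∀ k, z k ≤ m := fun k =>
      Finset.le_max' _ _ (Finset.mem_image_of_mem _ (Finset.mem_univ _))
    by_cases hI2 : (I.erase m).Nonempty
    · set m' := (I.erase m).max' hI2 with hm'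
      have hm'mem : m' ∈ I.erase m := Finset.max'_mem _ _
      have hlt : m' < m := by
        rw [Finset.mem_erase] at hm'mem
        exact lt_of_le_of_ne (Finset.le_max' _ _ hm'mem.2) hm'mem.1
      have hzm' : ∀ k, z k ≠ m → z k ≤ m' := fun k hk =>
        Finset.le_max' _ _ (Finset.mem_erase.mpr ⟨hk, Finset.mem_image_of_mem _ (Finset.mem_univ _)⟩)
      let U : Finset (Fin n) := Finset.univ.filter (fun k => z k = m)
      let z' : Fin n → ℝ := fun k => if z k = m then m' else z k
      have hdec : z = fun k => z' k + (m - m') * chi U k := by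
        funext k
        by_cases hk : z k = m <;> simp [z', U, chi, hk]
      have hM : mmap z = mmap z' + (m - m') • mmap (chi U) := by
        rw [← aux_smul _ (by linarith)]
        conv_lhs => rw [hdec]
        apply aux_add
        intro k l
        by_cases hk : z k = m <;> by_cases hl : z l = m <;> simp [z', U, chi, hk, hl]
        · have := hzm' l hl
          exact mul_nonneg (by linarith) (by linarith)
        · have := hzm' k hk
          nlinarith
      have hsub : Finset.univ.image z' ⊆ I.erase m := by
        intro y hy
        obtain ⟨k, -, rfl⟩ := Finset.mem_image.mp hy
        by_cases hk : z k = m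
        · simpa only [z', hk, if_true] using hm'mem
        · simp only [z', hk, if_false]
          exact Finset.mem_erase.mpr ⟨hk, Finset.mem_image_of_mem _ (Finset.mem_univ _)⟩
      have hcard : (Finset.univ.image z').card ≤ N := by
        have h1 := Finset.card_le_card hsub
        rw [Finset.card_erase_of_mem (Finset.max'_mem _ _)] at h1
        omega
      rw [hM, ← add_assoc]
      exact hS _ (ih z' hcard X hX) _ _ (by linarith)
    · have hall : ∀ k, z k = m := by
        intro k
        by_contra hk
        exact hI2 ⟨z k, Finset.mem_erase.mpr ⟨hk, Finset.mem_image_of_mem _ (Finset.mem_univ _)⟩⟩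
      have h0 : mmap z = 0 := by
        ext k l
        simp [mmap, hall]
      rw [h0, add_zero]; exact hX

theorem aux_sorted {n : ℕ} (x : Fin n → ℝ) (hx : ∀ k l : Fin n, k ≠ l → 1 ≤ |x k - x l|) :
    ∃ π : Equiv.Perm (Fin n), ∀ k l, π k ≤ π l →
      ((π l : ℕ) : ℝ) - ((π k : ℕ) : ℝ) ≤ x l - x k := by
  refine ⟨(Tuple.sort x)⁻¹, ?_⟩
  have hmono : Monotone (x ∘ Tuple.sort x) := Tuple.monotone_sort x
  have key : ∀ (d : ℕ) (i j : Fin n), (j : ℕ) = i + d →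
      (d : ℝ) ≤ x (Tuple.sort x j) - x (Tuple.sort x i) := by
    intro d
    induction d with
    | zero =>
      intro i j hij
      have : j = i := Fin.ext (by omega)
      subst this; simp
    | succ d ih =>
      intro i j hij
      have hj := j.2
      let j' : Fin n := ⟨i + d, by omega⟩
      have h1 := ih i j' rfl
      have hle : j' ≤ j := by
        rw [Fin.le_def]; simp only [j']; omega
      have h2 := hmono hle
      have hne : Tuple.sort x j ≠ Tuple.sort x j' := by
        intro h
        have := congrArg Fin.val ((Tuple.sort x).injective h)
        simp only [j'] at this; omega
      have h3 := hx _ _ hne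
      simp only [Function.comp] at h2
      rw [abs_of_nonneg (by linarith)] at h3
      push_cast
      linarith
  intro k l hkl
  rw [Fin.le_def] at hkl
  have := key ((((Tuple.sort x)⁻¹ l : Fin n) : ℕ) - (((Tuple.sort x)⁻¹ k : Fin n) : ℕ))
    ((Tuple.sort x)⁻¹ k) ((Tuple.sort x)⁻¹ l) (by omega)
  rw [Nat.cast_sub hkl] at this
  simpa using this

theorem aux_Ebn {n : ℕ} (S : Set (Matrix (Fin n) (Fin n) ℝ))
    (hS : ∀ X ∈ S, ∀ (U : Finset (Fin n)) (c : ℝ), 0 ≤ c → X + c • mmap (chi U) ∈ S)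
    (hP : ∀ π, Mperm π ∈ S) : Ebn n ⊆ S := by
  rintro X ⟨x, hx, rfl⟩
  obtain ⟨π, hπ⟩ := aux_sorted x hx
  have h : mmap x = Mperm π + mmap (fun k => x k - permVec π k) := by
    unfold Mperm
    rw [← aux_add]
    · congr 1; funext k; ring
    · intro k l
      unfold permVec
      rcases le_total (π k) (π l) with h | h
      · have h1 := hπ _ _ h
        have h2 : ((π k : ℕ) : ℝ) ≤ ((π l : ℕ) : ℝ) := by exact_mod_cast h
        exact mul_nonneg_of_nonpos_of_nonpos (by linarith) (by linarith)
      · have h1 := hπ _ _ h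
        have h2 : ((π l : ℕ) : ℝ) ≤ ((π k : ℕ) : ℝ) := by exact_mod_cast h
        exact mul_nonneg (by linarith) (by linarith)
  rw [h]
  exact aux_cone S hS _ _ le_rfl _ (hP π)

theorem aux_perm_mem {n : ℕ} (π : Equiv.Perm (Fin n)) : Mperm π ∈ Ebn n := by
  refine ⟨permVec π, ?_, rfl⟩
  intro k l hkl
  have h : ((π k : ℕ) : ℤ) - ((π l : ℕ) : ℤ) ≠ 0 := by
    intro h
    apply hkl
    apply π.injective
    apply Fin.ext
    omega
  have := Int.one_le_abs h
  have h2 : (1 : ℝ) ≤ |((π k : ℕ) : ℝ) - ((π l : ℕ) : ℝ)| := by exact_mod_cast this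
  unfold permVec
  rwa [add_sub_add_right_eq_sub]

/-- The closure of Q_n is stable under adding nonnegative multiples of cuts. -/
theorem aux_closure_add {n : ℕ} (X : Matrix (Fin n) (Fin n) ℝ) (hX : X ∈ closure (Qn n))
    (U : Finset (Fin n)) (c : ℝ) (hc : 0 ≤ c) : X + c • mmap (chi U) ∈ closure (Qn n) := by
  have hconv : Convex ℝ (closure (Qn n)) := (convex_convexHull ℝ _).closure

  obtain ⟨π, hπ⟩ := aux_sorted (fun k => ((k : ℕ) : ℝ) + n * chi U k) (by
    intro k l hkl
    have hk := k.2
    have hl := l.2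
    have hk' : ((k : ℕ) : ℝ) + 1 ≤ n := by exact_mod_cast hk
    have hl' : ((l : ℕ) : ℝ) + 1 ≤ n := by exact_mod_cast hl
    have hk0 : (0 : ℝ) ≤ ((k : ℕ) : ℝ) := Nat.cast_nonneg _
    have hl0 : (0 : ℝ) ≤ ((l : ℕ) : ℝ) := Nat.cast_nonneg _
    have hd : (1 : ℝ) ≤ |((k : ℕ) : ℝ) - ((l : ℕ) : ℝ)| := by
      have : ((k : ℕ) : ℤ) - ((l : ℕ) : ℤ) ≠ 0 := by
        intro h; apply hkl; apply Fin.ext; omega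
      exact_mod_cast Int.one_le_abs this
    by_cases h1 : k ∈ U <;> by_cases h2 : l ∈ U <;> simp [chi, h1, h2]
    · exact hd
    · rw [le_abs]; left; linarith
    · rw [le_abs]; right; linarith
    · exact hd)
  have hcompat : ∀ k l, 0 ≤ (permVec π k - permVec π l) * (chi U k - chi U l) := by
    intro k l
    have hk' : ((k : ℕ) : ℝ) + 1 ≤ n := by exact_mod_cast k.2
    have hl' : ((l : ℕ) : ℝ) + 1 ≤ n := by exact_mod_cast l.2
    have hk0 : (0 : ℝ) ≤ ((k : ℕ) : ℝ) := Nat.cast_nonneg _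
    have hl0 : (0 : ℝ) ≤ ((l : ℕ) : ℝ) := Nat.cast_nonneg _
    unfold permVec
    rcases le_total (π k) (π l) with h | h
    · have h1 := hπ _ _ h
      have h2 : ((π k : ℕ) : ℝ) ≤ ((π l : ℕ) : ℝ) := by exact_mod_cast h
      by_cases hkU : k ∈ U <;> by_cases hlU : l ∈ U <;> simp [chi, hkU, hlU] at h1 ⊢ <;>
        first | exact h | linarith
    · have h1 := hπ _ _ h
      have h2 : ((π l : ℕ) : ℝ) ≤ ((π k : ℕ) : ℝ) := by exact_mod_cast h
      by_cases hkU : k ∈ U <;> by_cases hlU : l ∈ U <;> simp [chi, hkU, hlU] at h1 ⊢ <;>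
        first | exact h | linarith
  have hray : ∀ t : ℝ, 0 ≤ t → Mperm π + t • mmap (chi U) ∈ closure (Qn n) := by
    intro t ht
    apply subset_closure
    apply subset_convexHull
    refine ⟨fun k => permVec π k + t * chi U k, ?_, ?_⟩
    · intro k l hkl
      obtain ⟨y, hy, hy2⟩ := aux_perm_mem π
      have h1 := hy k l hkl
      have h2 : |permVec π k - permVec π l| = |y k - y l| := congrFun (congrFun hy2 k) l
      rw [← h2] at h1
      have e : permVec π k + t * chi U k - (permVec π l + t * chi U l)
        = (permVec π k - permVec π l) + t * (chi U k - chi U l) := by ring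
      rw [e, abs_add_eq_add_abs_iff _ _ |>.mpr]
      · have := abs_nonneg (t * (chi U k - chi U l))
        linarith
      · apply mul_nonneg_iff.mp
        have := mul_nonneg ht (hcompat k l)
        linarith
    · rw [aux_add, aux_smul _ ht]
      · rfl
      · intro k l
        have := mul_nonneg ht (hcompat k l)
        linarith
  -- limit argument
  have hlim : Filter.Tendsto (fun N : ℕ => (1 - 1 / ((N : ℝ) + 1)) • X +
      (1 / ((N : ℝ) + 1)) • (Mperm π + (((N : ℝ) + 1) * c) • mmap (chi U))) Filter.atTop
      (nhds ((1 - (0 : ℝ)) • X + ((0 : ℝ) • Mperm π + c • mmap (chi U)))) := by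
    have ht : Filter.Tendsto (fun N : ℕ => 1 / ((N : ℝ) + 1)) Filter.atTop (nhds 0) :=
      tendsto_one_div_add_atTop_nhds_zero_nat
    have h3 := ((tendsto_const_nhds (x := (1 : ℝ))).sub ht).smul_const X |>.add
      ((ht.smul_const (Mperm π)).add_const (c • mmap (chi U)))
    refine h3.congr ?_
    intro N
    have hN : (N : ℝ) + 1 ≠ 0 := by positivity
    rw [smul_add, smul_smul, ← mul_assoc, one_div_mul_cancel hN, one_mul]
  have hmem := isClosed_closure.mem_of_tendsto hlim (Filter.Eventually.of_forall (fun N : ℕ => by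
    have hN : (0 : ℝ) < (N : ℝ) + 1 := by positivity
    have h1 : 1 / ((N : ℝ) + 1) ≤ 1 := by
      rw [div_le_one hN]
      have : (0 : ℝ) ≤ N := Nat.cast_nonneg _
      linarith
    exact hconv hX (hray _ (by positivity)) (by linarith) (by positivity) (by ring)))
  simpa using hmem

theorem aux_perm_eq {n : ℕ} (hn : 3 ≤ n) (π : Equiv.Perm (Fin n)) (h : Mperm π = Mperm 1) :
    π = 1 ∨ π = antipode 1 := by
  have h1 : ∀ k l : Fin n, |((π k : ℕ) : ℤ) - ((π l : ℕ) : ℤ)| = |((k : ℕ) : ℤ) - ((l : ℕ) : ℤ)| := by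
    intro k l
    have h2 := congrFun (congrFun h k) l
    simp only [Mperm, mmap, permVec, add_sub_add_right_eq_sub, Equiv.Perm.coe_one, id] at h2
    exact_mod_cast h2
  let z : Fin n := ⟨0, by omega⟩
  let e : Fin n := ⟨n - 1, by omega⟩
  have hz : (z : ℕ) = 0 := rfl
  have he : (e : ℕ) = n - 1 := rfl
  have h3 := h1 z e
  have hb1 := (π z).2
  have hb2 := (π e).2
  by_cases h0 : (π z : ℕ) = 0
  · left
    ext k
    have := h1 z k
    simp only [Equiv.Perm.coe_one, id]
    rw [hz] at this
    have h5 := (π k).2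
    simp only [abs_eq_max_neg] at this
    omega
  · right
    simp only [abs_eq_max_neg] at h3
    have h4 : (π z : ℕ) = n - 1 := by omega
    ext k
    have := h1 z k
    have h5 := (π k).2
    have h6 := k.2
    simp only [antipode, Equiv.trans_apply, Fin.revPerm_apply, Fin.val_rev, Equiv.Perm.coe_one, id]
    rw [hz] at this
    simp only [abs_eq_max_neg] at this
    omega

theorem aux_antipode {n : ℕ} : Mperm (antipode (1 : Equiv.Perm (Fin n))) = Mperm 1 := by
  ext k l
  have h6 := k.2
  have h7 := l.2
  have : |((((antipode 1 : Equiv.Perm (Fin n)) k : Fin n) : ℕ) : ℤ) -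
      ((((antipode 1 : Equiv.Perm (Fin n)) l : Fin n) : ℕ) : ℤ)| = |((k : ℕ) : ℤ) - ((l : ℕ) : ℤ)| := by
    simp only [antipode, Equiv.trans_apply, Fin.revPerm_apply, Fin.val_rev, Equiv.Perm.coe_one, id, abs_eq_max_neg]
    omega
  simp only [Mperm, mmap, permVec, add_sub_add_right_eq_sub, Equiv.Perm.coe_one, id]
  exact_mod_cast this

theorem aux_sum_perm {n : ℕ} (π : Equiv.Perm (Fin n)) :
    ∑ k, ∑ l, Mperm π k l = ∑ k : Fin n, ∑ l : Fin n, Mperm 1 k l := by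
  have h : ∀ k l, Mperm π k l = Mperm 1 (π k) (π l) := fun k l => rfl
  simp only [h]
  rw [Equiv.sum_comp π (fun k => ∑ l, Mperm 1 k (π l))]
  exact Finset.sum_congr rfl (fun k _ => Equiv.sum_comp π (fun l => Mperm 1 k l))

theorem aux_chi_ne {n : ℕ} (U : Finset (Fin n)) (k l : Fin n) :
    mmap (chi U) k l = 0 ↔ (k ∈ U ↔ l ∈ U) := by
  by_cases h1 : k ∈ U <;> by_cases h2 : l ∈ U <;> simp [mmap, chi, h1, h2]

theorem aux_compl {n : ℕ} (U : Finset (Fin n)) : mmap (chi Uᶜ) = mmap (chi U) := by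
  ext k l
  by_cases h1 : k ∈ U <;> by_cases h2 : l ∈ U <;> simp [mmap, chi, h1, h2]

theorem aux_exists_ne {n : ℕ} (U : Finset (Fin n)) (hU : U.Nonempty) (hU' : U ≠ Finset.univ) :
    ∃ k l, mmap (chi U) k l ≠ 0 := by
  obtain ⟨k, hk⟩ := hU
  obtain ⟨l, hl⟩ : ∃ l, l ∉ U := by
    by_contra! h
    exact hU' (Finset.eq_univ_iff_forall.mpr h)
  refine ⟨k, l, ?_⟩
  rw [Ne, aux_chi_ne]
  tauto

theorem aux_cut_eq {n : ℕ} (U V : Finset (Fin n)) (hV : V.Nonempty) (hV' : V ≠ Finset.univ)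
    (t : ℝ) (h : mmap (chi V) = t • mmap (chi U)) : V = U ∨ V = Uᶜ := by
  obtain ⟨a, b, hab⟩ := aux_exists_ne V hV hV'
  have hent : ∀ k l, mmap (chi V) k l = t * mmap (chi U) k l := fun k l =>
    congrFun (congrFun h k) l
  have ht : t ≠ 0 := by
    rintro rfl
    apply hab
    rw [hent]; simp
  have key : ∀ k l, (k ∈ V ↔ l ∈ V) ↔ (k ∈ U ↔ l ∈ U) := by
    intro k l
    rw [← aux_chi_ne, ← aux_chi_ne, hent]
    simp [ht]
  by_cases ha : a ∈ V ↔ a ∈ U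
  · left
    ext k
    have := key a k
    tauto
  · right
    ext k
    have := key a k
    rw [Finset.mem_compl]
    tauto

/-- The linear functional attached to a matrix. -/
noncomputable def auxDot {n : ℕ} (D : Matrix (Fin n) (Fin n) ℝ) :
    Matrix (Fin n) (Fin n) ℝ →ₗ[ℝ] ℝ where
  toFun := mdot D
  map_add' X Y := by
    simp only [mdot, Matrix.add_apply, mul_add, Finset.sum_add_distrib]
  map_smul' c X := by
    simp only [mdot, Matrix.smul_apply, smul_eq_mul, RingHom.id_apply, Finset.mul_sum]
    refine Finset.sum_congr rfl (fun k _ => Finset.sum_congr rfl (fun l _ => by ring))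

theorem aux_halfline_sub {n : ℕ} (U : Finset (Fin n)) : halfline 1 U ⊆ closure (Qn n) := by
  rintro X ⟨t, ht, rfl⟩
  exact aux_closure_add _ (subset_closure (subset_convexHull ℝ _ (aux_perm_mem 1))) U t ht

theorem aux_halfline_closed {n : ℕ} (U : Finset (Fin n)) (hU : U.Nonempty)
    (hU' : U ≠ Finset.univ) : IsClosed (halfline 1 U) := by
  obtain ⟨a, b, hab⟩ := aux_exists_ne U hU hU'
  set r := mmap (chi U) with hr
  have heq : halfline 1 U = {X | 0 ≤ (X a b - Mperm 1 a b) / r a b ∧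
      X = Mperm 1 + ((X a b - Mperm 1 a b) / r a b) • r} := by
    ext X
    constructor
    · rintro ⟨t, ht, rfl⟩
      have e : (((Mperm 1 + t • r : Matrix (Fin n) (Fin n) ℝ)) a b - Mperm 1 a b) / r a b = t := by
        rw [Matrix.add_apply, Matrix.smul_apply, smul_eq_mul]
        field_simp
        ring
      exact ⟨by rw [e]; exact ht, by rw [e]⟩
    · rintro ⟨h1, h2⟩
      exact ⟨_, h1, h2⟩
  rw [heq]
  have hc : Continuous (fun X : Matrix (Fin n) (Fin n) ℝ => (X a b - Mperm 1 a b) / r a b) := by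
    apply Continuous.div_const
    exact (continuous_id.matrix_elem a b).sub continuous_const
  exact (isClosed_le continuous_const hc).inter
    (isClosed_eq continuous_id (continuous_const.add (hc.smul continuous_const)))

theorem aux_backward {n : ℕ} (U : Finset (Fin n))
    (hU : U.Nonempty) (hU' : U ≠ Finset.univ) (D : Matrix (Fin n) (Fin n) ℝ)
    (h1 : ∀ π : Equiv.Perm (Fin n), π ≠ 1 → π ≠ antipode 1 →
          mdot D (Mperm 1) < mdot D (Mperm π))
    (h2 : ∀ U' : Finset (Fin n), U'.Nonempty → U' ≠ Finset.univ → U' ≠ U → U' ≠ Uᶜ →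
          0 < mdot D (mmap (chi U')))
    (h3 : mdot D (mmap (chi U)) = 0) :
    IsExtreme ℝ (closure (Qn n)) (halfline 1 U) := by
  set v : Matrix (Fin n) (Fin n) ℝ := Mperm 1 with hv
  set r := mmap (chi U) with hr
  have h1' : ∀ π : Equiv.Perm (Fin n), π ≠ 1 → π ≠ antipode 1 →
    0 < auxDot D (Mperm π - v) := by
    intro π ha hb
    rw [map_sub]
    exact sub_pos.mpr (h1 π ha hb)
  have h3' : auxDot D r = 0 := h3
  -- a uniform constant
  have hC : ∃ C : ℝ, 0 ≤ C ∧ (∀ π : Equiv.Perm (Fin n), π ≠ 1 → π ≠ antipode 1 →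
      ‖Mperm π - v‖ ≤ C * auxDot D (Mperm π - v)) ∧
      (∀ U' : Finset (Fin n), U'.Nonempty → U' ≠ Finset.univ → U' ≠ U → U' ≠ Uᶜ →
        ‖mmap (chi U')‖ ≤ C * auxDot D (mmap (chi U'))) := by
    have hb : ∀ a b : ℝ, 0 < b → ∀ᶠ C in Filter.atTop, a ≤ C * b := by
      intro a b hb
      exact (Filter.tendsto_id.atTop_mul_const hb).eventually_ge_atTop a
    have e1 : ∀ᶠ C : ℝ in Filter.atTop, ∀ π : Equiv.Perm (Fin n), π ≠ 1 → π ≠ antipode 1 →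
      ‖Mperm π - v‖ ≤ C * auxDot D (Mperm π - v) := by
      rw [Filter.eventually_all]
      intro π
      by_cases hp : π ≠ 1 ∧ π ≠ antipode 1
      · exact (hb _ _ (h1' π hp.1 hp.2)).mono (fun C h _ _ => h)
      · exact Filter.Eventually.of_forall (fun C x y => absurd ⟨x, y⟩ hp)
    have e2 : ∀ᶠ C : ℝ in Filter.atTop, ∀ U' : Finset (Fin n), U'.Nonempty →
        U' ≠ Finset.univ → U' ≠ U → U' ≠ Uᶜ →
        ‖mmap (chi U')‖ ≤ C * auxDot D (mmap (chi U')) := by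
      rw [Filter.eventually_all]
      intro V
      by_cases hp : V.Nonempty ∧ V ≠ Finset.univ ∧ V ≠ U ∧ V ≠ Uᶜ
      · exact (hb _ _ (h2 V hp.1 hp.2.1 hp.2.2.1 hp.2.2.2)).mono (fun C h _ _ _ _ => h)
      · exact Filter.Eventually.of_forall (fun C x y z w => absurd ⟨x, y, z, w⟩ hp)
    obtain ⟨C, hC⟩ := ((Filter.eventually_ge_atTop (0 : ℝ)).and (e1.and e2)).exists
    exact ⟨C, hC.1, hC.2.1, hC.2.2⟩
  obtain ⟨C, hC0, hC1, hC2⟩ := hC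
  let S : Set (Matrix (Fin n) (Fin n) ℝ) :=
    {X | ∃ t : ℝ, 0 ≤ t ∧ ‖X - v - t • r‖ ≤ C * auxDot D (X - v)}
  have hSconv : Convex ℝ S := by
    rintro X ⟨s, hs, hX⟩ Y ⟨t, ht, hY⟩ a b ha hb hab
    refine ⟨a * s + b * t, by positivity, ?_⟩
    have e1 : a • X + b • Y - v = a • (X - v) + b • (Y - v) := by
      have : v = (a + b) • v := by rw [hab, one_smul]
      conv_lhs => rw [this]
      module
    have e2 : a • X + b • Y - v - (a * s + b * t) • r
        = a • (X - v - s • r) + b • (Y - v - t • r) := by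
      rw [e1]; module
    rw [e2, e1, map_add, map_smul, map_smul, smul_eq_mul, smul_eq_mul]
    refine (norm_add_le _ _).trans ?_
    rw [norm_smul, norm_smul, Real.norm_of_nonneg ha, Real.norm_of_nonneg hb]
    have := mul_le_mul_of_nonneg_left hX ha
    have := mul_le_mul_of_nonneg_left hY hb
    linarith
  have hSadd : ∀ X ∈ S, ∀ (V : Finset (Fin n)) (c : ℝ), 0 ≤ c → X + c • mmap (chi V) ∈ S := by
    rintro X ⟨t, ht, hX⟩ V c hc
    have good : mmap (chi V) = r → X + c • mmap (chi V) ∈ S := by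
      intro h
      refine ⟨t + c, by positivity, ?_⟩
      have e1 : X + c • mmap (chi V) - v - (t + c) • r = X - v - t • r := by
        rw [h]; module
      have e2 : X + c • mmap (chi V) - v = (X - v) + c • r := by
        rw [h]; module
      rw [e1, e2, map_add, map_smul, h3', smul_zero, add_zero]
      exact hX
    have zero : mmap (chi V) = 0 → X + c • mmap (chi V) ∈ S := by
      intro h
      rw [h, smul_zero, add_zero]
      exact ⟨t, ht, hX⟩
    by_cases hV1 : V.Nonempty
    swap
    · apply zero
      rw [Finset.not_nonempty_iff_eq_empty] at hV1
      ext k l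
      simp [mmap, chi, hV1]
    by_cases hV2 : V = Finset.univ
    · apply zero
      ext k l
      simp [mmap, chi, hV2]
    by_cases hV3 : V = U
    · apply good; rw [hV3]
    by_cases hV4 : V = Uᶜ
    · apply good; rw [hV4, aux_compl]
    refine ⟨t, ht, ?_⟩
    have e1 : X + c • mmap (chi V) - v - t • r = (X - v - t • r) + c • mmap (chi V) := by module
    have e2 : X + c • mmap (chi V) - v = (X - v) + c • mmap (chi V) := by module
    rw [e1, e2, map_add, map_smul, smul_eq_mul]
    refine (norm_add_le _ _).trans ?_
    rw [norm_smul, Real.norm_of_nonneg hc]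
    have := mul_le_mul_of_nonneg_left (hC2 V hV1 hV2 hV3 hV4) hc
    linarith
  have hSperm : ∀ π, Mperm π ∈ S := by
    intro π
    refine ⟨0, le_rfl, ?_⟩
    rw [zero_smul, sub_zero]
    by_cases ha : π = 1
    · rw [ha, ← hv]; simp
    by_cases hb : π = antipode 1
    · rw [hb, aux_antipode, ← hv]; simp
    exact hC1 π ha hb
  have hQS : Qn n ⊆ S := convexHull_min (aux_Ebn S hSadd hSperm) hSconv
  have hcont : Continuous (fun X => auxDot D (X - v)) :=
    (LinearMap.continuous_of_finiteDimensional (auxDot D)).comp (continuous_id.sub continuous_const)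
  have hne : (halfline 1 U).Nonempty := ⟨v, 0, le_rfl, by simp [hv]⟩
  have hbound : ∀ X ∈ closure (Qn n), Metric.infDist X (halfline 1 U) ≤ C * auxDot D (X - v) := by
    have hcl : IsClosed {X : Matrix (Fin n) (Fin n) ℝ |
        Metric.infDist X (halfline 1 U) ≤ C * auxDot D (X - v)} :=
      isClosed_le (Metric.continuous_infDist_pt _) (continuous_const.mul hcont)
    intro X hX
    refine closure_minimal ?_ hcl hX
    intro Y hY
    obtain ⟨t, ht, hYt⟩ := hQS hY
    have : Metric.infDist Y (halfline 1 U) ≤ dist Y (v + t • r) :=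
      Metric.infDist_le_dist_of_mem ⟨t, ht, rfl⟩
    rw [dist_eq_norm, ← sub_sub] at this
    exact this.trans hYt
  have hpos : ∀ X ∈ closure (Qn n), 0 ≤ auxDot D (X - v) := by
    have hcl : IsClosed {X : Matrix (Fin n) (Fin n) ℝ | 0 ≤ auxDot D (X - v)} :=
      isClosed_le continuous_const hcont
    intro X hX
    refine closure_minimal (convexHull_min (aux_Ebn _ ?_ ?_) ?_) hcl hX
    · intro X hX V c hc
      show 0 ≤ auxDot D (X + c • mmap (chi V) - v)
      have e2 : X + c • mmap (chi V) - v = (X - v) + c • mmap (chi V) := by module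
      rw [e2, map_add, map_smul, smul_eq_mul]
      refine add_nonneg hX (mul_nonneg hc ?_)
      by_cases hV1 : V.Nonempty
      swap
      · rw [Finset.not_nonempty_iff_eq_empty] at hV1
        have : mmap (chi V) = 0 := by
          ext k l
          simp [mmap, chi, hV1]
        rw [this, map_zero]
      by_cases hV2 : V = Finset.univ
      · have : mmap (chi V) = 0 := by
          ext k l
          simp [mmap, chi, hV2]
        rw [this, map_zero]
      by_cases hV3 : V = U
      · rw [hV3, h3']
      by_cases hV4 : V = Uᶜ
      · rw [hV4, aux_compl, h3']
      exact (h2 V hV1 hV2 hV3 hV4).le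
    · intro π
      show 0 ≤ auxDot D (Mperm π - v)
      by_cases ha : π = 1
      · rw [ha, ← hv]; simp
      by_cases hb : π = antipode 1
      · rw [hb, aux_antipode, ← hv]; simp
      exact (h1' π ha hb).le
    · intro X hX Y hY a b ha hb hab
      show 0 ≤ auxDot D (a • X + b • Y - v)
      have e1 : a • X + b • Y - v = a • (X - v) + b • (Y - v) := by
        have : v = (a + b) • v := by rw [hab, one_smul]
        conv_lhs => rw [this]
        module
      rw [e1, map_add, map_smul, map_smul]
      exact add_nonneg (mul_nonneg ha hX) (mul_nonneg hb hY)
  have hface : ∀ X ∈ closure (Qn n), auxDot D (X - v) = 0 → X ∈ halfline 1 U := by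
    intro X hX h0
    have h4 := hbound X hX
    rw [h0, mul_zero] at h4
    exact ((aux_halfline_closed U hU hU').mem_iff_infDist_zero hne).mpr
      (le_antisymm h4 Metric.infDist_nonneg)
  refine ⟨aux_halfline_sub U, ?_⟩
  rintro X hX Y hY Z ⟨t, ht, hZ⟩ ⟨a, b, ha, hb, hab, hZ2⟩
  have hz : auxDot D (Z - v) = 0 := by
    rw [hZ, ← hv, add_sub_cancel_left, map_smul, h3', smul_zero]
  have e1 : Z - v = a • (X - v) + b • (Y - v) := by
    have : v = (a + b) • v := by rw [hab, one_smul]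
    conv_lhs => rw [this, ← hZ2]
    module
  rw [e1, map_add, map_smul, map_smul, smul_eq_mul, smul_eq_mul] at hz
  apply hface X hX
  have p1 := hpos X hX
  have p2 := mul_nonneg hb.le (hpos Y hY)
  have p3 := mul_nonneg ha.le p1
  have p4 : a * auxDot D (X - v) = 0 := by linarith
  rcases mul_eq_zero.mp p4 with h | h
  · exact absurd h ha.ne'
  · exact h

/-- Represent a linear functional on matrices by a symmetric hollow matrix. -/
theorem aux_repr {n : ℕ} (f : Matrix (Fin n) (Fin n) ℝ →ₗ[ℝ] ℝ) :
    ∃ D : Matrix (Fin n) (Fin n) ℝ, (∀ k l, D k l = D l k) ∧ (∀ k, D k k = 0) ∧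
      ∀ x : Fin n → ℝ, mdot D (mmap x) = f (mmap x) := by
  let g : Fin n → Fin n → ℝ := fun k l => f (Matrix.single k l 1)
  refine ⟨fun k l => if k = l then 0 else (g k l + g l k) / 2, ?_, ?_, ?_⟩
  · intro k l
    by_cases h : k = l
    · simp [h]
    · simp [h, Ne.symm h, add_comm]
  · intro k; simp
  · intro x
    have hsymm : ∀ k l, mmap x k l = mmap x l k := fun k l => abs_sub_comm _ _
    have hf : f (mmap x) = ∑ k, ∑ l, g k l * mmap x k l := by
      conv_lhs => rw [Matrix.matrix_eq_sum_single (mmap x)]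
      rw [map_sum]
      refine Finset.sum_congr rfl (fun k _ => ?_)
      rw [map_sum]
      refine Finset.sum_congr rfl (fun l _ => ?_)
      have : Matrix.single k l (mmap x k l) = mmap x k l • Matrix.single k l (1 : ℝ) := by
        rw [Matrix.smul_single, smul_eq_mul, mul_one]
      rw [this, map_smul, smul_eq_mul, mul_comm]
    have hf2 : f (mmap x) = ∑ k, ∑ l, g l k * mmap x k l := by
      rw [hf, Finset.sum_comm]
      refine Finset.sum_congr rfl (fun k _ => Finset.sum_congr rfl (fun l _ => ?_))
      rw [hsymm]
    have hm : mdot (fun k l => if k = l then 0 else (g k l + g l k) / 2) (mmap x)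
        = ∑ k, ∑ l, (g k l * mmap x k l + g l k * mmap x k l) / 2 := by
      refine Finset.sum_congr rfl (fun k _ => Finset.sum_congr rfl (fun l _ => ?_))
      by_cases h : k = l
      · subst h; simp [mmap]
      · simp only [h, if_false]; ring
    rw [hm]
    simp only [← Finset.sum_div, Finset.sum_add_distrib]
    rw [← hf, ← hf2]; ring

theorem aux_forward {n : ℕ} (hn : 3 ≤ n) (U : Finset (Fin n))
    (hU : U.Nonempty) (hU' : U ≠ Finset.univ)
    (hE : IsExtreme ℝ (closure (Qn n)) (halfline 1 U)) :
    ∃ f : Matrix (Fin n) (Fin n) ℝ →ₗ[ℝ] ℝ,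
        (∀ π : Equiv.Perm (Fin n), π ≠ 1 → π ≠ antipode 1 → f (Mperm 1) < f (Mperm π)) ∧
        (∀ U' : Finset (Fin n), U'.Nonempty → U' ≠ Finset.univ → U' ≠ U → U' ≠ Uᶜ →
          0 < f (mmap (chi U'))) ∧
        f (mmap (chi U)) = 0 := by
  classical
  set v : Matrix (Fin n) (Fin n) ℝ := Mperm 1 with hv
  set r := mmap (chi U) with hr
  let ι := {π : Equiv.Perm (Fin n) // π ≠ 1 ∧ π ≠ antipode 1} ⊕
    {V : Finset (Fin n) // V.Nonempty ∧ V ≠ Finset.univ ∧ V ≠ U ∧ V ≠ Uᶜ}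
  let g : ι → Matrix (Fin n) (Fin n) ℝ :=
    Sum.elim (fun π => Mperm π.1 - v) (fun V => mmap (chi V.1))
  have hA : Convex ℝ (closure (Qn n)) := (convex_convexHull ℝ _).closure
  have hPA : ∀ π : Equiv.Perm (Fin n), Mperm π ∈ closure (Qn n) := fun π =>
    subset_closure (subset_convexHull ℝ _ (aux_perm_mem π))
  have hgA : ∀ i, v + g i ∈ closure (Qn n) := by
    rintro (π | V)
    · simpa [g] using hPA π.1
    · have := aux_closure_add v (hPA 1) V.1 1 zero_le_one
      simpa [g] using this
  have hgt : ∀ (i : ι) (t : ℝ), g i ≠ t • r := by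
    rintro (π | V) t h
    · replace h : Mperm π.1 - v = t • r := h
      have h' : ∀ k l, Mperm π.1 k l - v k l = t * r k l := fun k l =>
        congrFun (congrFun h k) l
      have hs : ∑ k, ∑ l, (Mperm π.1 k l - v k l) = t * ∑ k, ∑ l, r k l := by
        simp only [h', Finset.mul_sum]
      simp only [Finset.sum_sub_distrib] at hs
      rw [aux_sum_perm, ← hv, sub_self] at hs
      obtain ⟨a, b, hab⟩ := aux_exists_ne U hU hU'
      have hr0 : ∀ k l, 0 ≤ r k l := fun k l => abs_nonneg _
      have hrpos : 0 < ∑ k, ∑ l, r k l := by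
        refine Finset.sum_pos' (fun k _ => Finset.sum_nonneg (fun l _ => hr0 k l))
          ⟨a, Finset.mem_univ _, Finset.sum_pos' (fun l _ => hr0 a l)
            ⟨b, Finset.mem_univ _, lt_of_le_of_ne (hr0 a b) (Ne.symm hab)⟩⟩
      have ht : t = 0 := by
        rcases mul_eq_zero.mp hs.symm with h | h
        · exact h
        · exact absurd h hrpos.ne'
      rw [ht, zero_smul, sub_eq_zero] at h
      rcases aux_perm_eq hn π.1 h with h | h
      · exact π.2.1 h
      · exact π.2.2 h
    · rcases aux_cut_eq U V.1 V.2.1 V.2.2.1 t h with h | h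
      · exact V.2.2.2.1 h
      · exact V.2.2.2.2 h
  have hdisj : Disjoint (convexHull ℝ (Set.range g)) (Set.range (fun t : ℝ => t • r)) := by
    rw [Set.disjoint_left]
    rintro X hX ⟨s, hs⟩
    obtain ⟨κ, hκ, w, z, hw0, hw1, hz, hsum⟩ := mem_convexHull_iff_exists_fintype.mp hX
    obtain ⟨i, hi⟩ : ∃ i, 0 < w i := by
      by_contra! h
      have : ∑ i, w i ≤ 0 := Finset.sum_nonpos (fun i _ => h i)
      linarith
    have hzA : ∀ j, v + z j ∈ closure (Qn n) := by
      intro j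
      obtain ⟨k, hk⟩ := hz j
      rw [← hk]; exact hgA k
    have hvA : v ∈ closure (Qn n) := hPA 1
    have hwi : w i ≤ 1 := by
      rw [← hw1]
      exact Finset.single_le_sum (fun j _ => hw0 j) (Finset.mem_univ i)
    -- the two summands
    have h1 : v + w i • z i ∈ closure (Qn n) := by
      have := hA hvA (hzA i) (sub_nonneg.mpr hwi) hi.le (by ring)
      convert this using 1
      module
    let d2 : Matrix (Fin n) (Fin n) ℝ := ∑ j, w j • (if j = i then 0 else z j)
    have h2 : v + d2 ∈ closure (Qn n) := by
      have := hA.sum_mem (t := Finset.univ) (w := w) (z := fun j => v + if j = i then 0 else z j)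
        (fun j _ => hw0 j) hw1 (fun j _ => by
          by_cases hj : j = i
          · simpa [hj] using hvA
          · simpa [hj] using hzA j)
      simp only [smul_add, Finset.sum_add_distrib, ← Finset.sum_smul, hw1, one_smul] at this
      exact this
    have h12 : w i • z i + d2 = s • r := by
      have e : w i • z i = ∑ j, w j • (if j = i then z j else 0) := by
        simp
      have hs' : s • r = ∑ j, w j • z j := by rw [hsum]; exact hs
      rw [e, hs', ← Finset.sum_add_distrib]
      refine Finset.sum_congr rfl (fun j _ => ?_)
      by_cases hj : j = i <;> simp [hj]
    have hmem : v + w i • z i ∈ halfline 1 U := by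
      rcases le_total 0 s with h0 | h0
      · refine hE.2 h1 h2 (z := v + (s / 2) • r) ⟨s / 2, by positivity, rfl⟩
          ⟨1 / 2, 1 / 2, by norm_num, by norm_num, by norm_num, ?_⟩
        have : (s / 2) • r = (1 / 2 : ℝ) • (w i • z i + d2) := by
          rw [h12, smul_smul]; congr 1; ring
        rw [this]; module
      · refine hE.2 h1 (aux_closure_add _ h2 U (-s) (by linarith)) (z := v)
          ⟨0, le_rfl, by simp [hv]⟩
          ⟨1 / 2, 1 / 2, by norm_num, by norm_num, by norm_num, ?_⟩
        have e : d2 = s • r - w i • z i := by rw [← h12]; abel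
        rw [e, ← hr]; module
    obtain ⟨t, ht, hteq⟩ := hmem
    have h5 : w i • z i = t • r := add_left_cancel hteq
    obtain ⟨k, hk⟩ := hz i
    apply hgt k ((w i)⁻¹ * t)
    rw [hk, mul_smul, ← h5, inv_smul_smul₀ hi.ne']
  have : LocallyConvexSpace ℝ (Matrix (Fin n) (Fin n) ℝ) :=
    inferInstanceAs (LocallyConvexSpace ℝ (Fin n → Fin n → ℝ))
  have hline : Set.range (fun t : ℝ => t • r) = (Submodule.span ℝ {r} : Set _) := by
    ext X
    simp [Submodule.mem_span_singleton]
  rw [hline] at hdisj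
  obtain ⟨f, a, b, hfa, hab, hfb⟩ := geometric_hahn_banach_compact_closed
    (convex_convexHull ℝ (Set.range g))
    ((Set.finite_range g).isCompact_convexHull ℝ)
    (Submodule.convex _) (Submodule.closed_of_finiteDimensional (Submodule.span ℝ {r})) hdisj
  have hb0 : b < 0 := by simpa using hfb 0 (Submodule.zero_mem _)
  have hfr : f r = 0 := by
    by_contra h
    have := hfb ((b / f r) • r) (Submodule.smul_mem _ _ (Submodule.mem_span_singleton_self r))
    rw [map_smul, smul_eq_mul, div_mul_cancel₀ _ h] at this
    exact lt_irrefl _ this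
  have hneg : ∀ i, f (g i) < 0 := fun i =>
    (hfa _ (subset_convexHull ℝ _ (Set.mem_range_self i))).trans (hab.trans hb0)
  refine ⟨-(f : Matrix (Fin n) (Fin n) ℝ →ₗ[ℝ] ℝ), ?_, ?_, ?_⟩
  · intro π hp hq
    have : f (Mperm π - v) < 0 := hneg (Sum.inl ⟨π, hp, hq⟩)
    rw [map_sub] at this
    show -f v < -f (Mperm π)
    linarith
  · intro V p1 p2 p3 p4
    have : f (mmap (chi V)) < 0 := hneg (Sum.inr ⟨V, p1, p2, p3, p4⟩)
    show 0 < -f (mmap (chi V))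
    linarith
  · show -f r = 0
    rw [hfr, neg_zero]

theorem stmt15 (n : ℕ) (hn : 3 ≤ n) (U : Finset (Fin n))
    (hU : U.Nonempty) (hU' : U ≠ Finset.univ) :
    IsExtreme ℝ (closure (Qn n)) (halfline 1 U) ↔
      ∃ D : Matrix (Fin n) (Fin n) ℝ, (∀ k l, D k l = D l k) ∧ (∀ k, D k k = 0) ∧
        (∀ π : Equiv.Perm (Fin n), π ≠ 1 → π ≠ antipode 1 →
          mdot D (Mperm 1) < mdot D (Mperm π)) ∧
        (∀ U' : Finset (Fin n), U'.Nonempty → U' ≠ Finset.univ → U' ≠ U → U' ≠ Uᶜ →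
          0 < mdot D (mmap (chi U'))) ∧
        mdot D (mmap (chi U)) = 0 := by
  constructor
  · intro hE
    obtain ⟨f, h1, h2, h3⟩ := aux_forward hn U hU hU' hE
    obtain ⟨D, hs, hd, hD⟩ := aux_repr f
    refine ⟨D, hs, hd, ?_, ?_, ?_⟩
    · intro π hp hq
      have := h1 π hp hq
      unfold Mperm at this ⊢
      rwa [hD, hD]
    · intro V p1 p2 p3 p4
      rw [hD]; exact h2 V p1 p2 p3 p4
    · rw [hD]; exact h3
  · rintro ⟨D, -, -, h1, h2, h3⟩
    exact aux_backward U hU hU' D h1 h2 h3
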